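/- arXiv:2002.09432 — 12 statements merged into one kernel-verified Lean document; each statement's English description precedes it below -/
import Mathlib

section
/- Let U be a nonsingular nonnegative real n×n matrix. If for every vector x ∈ ℝⁿ one has ⟨(Ux − 𝟙)⁺, x⟩ ≥ 0, then U is a potential matrix, i.e. M = U⁻¹ satisfies M_{ij} ≤ 0 for all i ≠ j, M_{ii} > 0 for all i, and M_{ii} ≥ Σ_{j≠i} |M_{ij}| for all i. -/
open Matrix Finset

/-- Under the positivity hypothesis, `U⁻¹ y` is nonnegative at `i` as soon as `i` is the only
coordinate where `y` exceeds `1`. -/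
lemma inv_mulVec_nonneg_of_le_one {n : ℕ} {U : Matrix (Fin n) (Fin n) ℝ} (hns : IsUnit U.det)
    (h : ∀ x : Fin n → ℝ, 0 ≤ ∑ i, max (U.mulVec x i - 1) 0 * x i)
    {y : Fin n → ℝ} {i : Fin n} (hi : 1 < y i) (hy : ∀ k, k ≠ i → y k ≤ 1) :
    0 ≤ (U⁻¹ *ᵥ y) i := by
  have hx := h (U⁻¹ *ᵥ y)
  rw [Matrix.mulVec_mulVec, Matrix.mul_nonsing_inv U hns, Matrix.one_mulVec,
    Finset.sum_eq_single i, max_eq_left (by linarith)] at hx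
  · exact nonneg_of_mul_nonneg_right hx (by linarith)
  · intro k _ hk
    rw [max_eq_right (by linarith [hy k hk]), zero_mul]
  · simp

/-- If a nonsingular nonnegative matrix `U` satisfies
`⟨(Ux − 𝟙)⁺, x⟩ ≥ 0` for all `x`, then `U` is a potential matrix. -/
theorem stmt_0 {n : ℕ} (U : Matrix (Fin n) (Fin n) ℝ)
    (hU : ∀ i j, 0 ≤ U i j) (hns : IsUnit U.det)
    (h : ∀ x : Fin n → ℝ, 0 ≤ ∑ i, max (U.mulVec x i - 1) 0 * x i) :
    (∀ i j, i ≠ j → U⁻¹ i j ≤ 0) ∧ (∀ i, 0 < U⁻¹ i i) ∧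
      (∀ i, ∑ j ∈ Finset.univ.erase i, |U⁻¹ i j| ≤ U⁻¹ i i) := by
  have hdiag : ∀ i, ∀ t : ℝ, 0 < t → 0 ≤ (U⁻¹ *ᵥ 1) i + U⁻¹ i i * t := by
    intro i t ht
    have := inv_mulVec_nonneg_of_le_one hns h (y := 1 + Pi.single i t) (i := i)
      (by simpa using ht) (fun k hk => by simp [hk])
    simpa [Matrix.mulVec_add, Matrix.mulVec_single, mul_comm] using this
  have hoff : ∀ i j, i ≠ j → U⁻¹ i j ≤ 0 := by
    intro i j hij
    by_contra! hpos
    set r := (U⁻¹ *ᵥ 1) i + U⁻¹ i i with hr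
    have hbound : ∀ s : ℝ, 0 ≤ s → 0 ≤ r - U⁻¹ i j * s := by
      intro s hs
      have := inv_mulVec_nonneg_of_le_one hns h
        (y := 1 + Pi.single i 1 - Pi.single j s) (i := i)
        (by simp [hij]) (fun k hk => by
          have : 0 ≤ (Pi.single j s : Fin n → ℝ) k := by
            rw [Pi.single_apply]
            split_ifs <;> simp [hs]
          simpa [hk] using this)
      simpa [Matrix.mulVec_add, Matrix.mulVec_sub, Matrix.mulVec_single, mul_comm, hr] using this
    have hr0 : 0 ≤ r := by simpa using hbound 0 le_rfl
    have := hbound ((r + 1) / U⁻¹ i j) (by positivity)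
    rw [mul_div_cancel₀ _ hpos.ne'] at this
    linarith
  have hrow : ∀ i, 0 ≤ (U⁻¹ *ᵥ 1) i := by
    intro i
    by_contra! hneg
    have h1 := hdiag i 1 one_pos
    have hd : 0 < U⁻¹ i i := by linarith
    have := hdiag i (-(U⁻¹ *ᵥ 1) i / (2 * U⁻¹ i i)) (div_pos (by linarith) (by linarith))
    have he : U⁻¹ i i * (-(U⁻¹ *ᵥ 1) i / (2 * U⁻¹ i i)) = -(U⁻¹ *ᵥ 1) i / 2 := by
      field_simp
    linarith
  have hdom : ∀ i, ∑ j ∈ Finset.univ.erase i, |U⁻¹ i j| ≤ U⁻¹ i i := by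
    intro i
    have hsum : (U⁻¹ *ᵥ 1) i = U⁻¹ i i + ∑ j ∈ Finset.univ.erase i, U⁻¹ i j := by
      rw [Finset.add_sum_erase _ _ (Finset.mem_univ i)]
      simp [Matrix.mulVec, dotProduct]
    have habs : ∑ j ∈ Finset.univ.erase i, |U⁻¹ i j| =
        -∑ j ∈ Finset.univ.erase i, U⁻¹ i j := by
      rw [← Finset.sum_neg_distrib]
      exact Finset.sum_congr rfl fun j hj =>
        abs_of_nonpos (hoff i j (Finset.ne_of_mem_erase hj).symm)
    linarith [hrow i]
  refine ⟨hoff, fun i => ?_, hdom⟩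
  by_contra! hle
  have hnn : 0 ≤ ∑ j ∈ Finset.univ.erase i, |U⁻¹ i j| :=
    Finset.sum_nonneg fun j _ => abs_nonneg _
  have hz : ∑ j ∈ Finset.univ.erase i, |U⁻¹ i j| = 0 := by linarith [hdom i]
  have hzero : ∀ j, U⁻¹ i j = 0 := by
    intro j
    by_cases hj : j = i
    · subst hj
      linarith [hdom j]
    · exact abs_eq_zero.1 ((Finset.sum_eq_zero_iff_of_nonneg fun j _ => abs_nonneg _).1 hz j
        (Finset.mem_erase.2 ⟨hj, Finset.mem_univ j⟩))
  exact (Matrix.isUnit_nonsing_inv_det U hns).ne_zero (Matrix.det_eq_zero_of_row_eq_zero i hzero)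
end

section
/- Let U be a nonsingular nonnegative real n×n matrix such that both U and its transpose Uᵗ are potential matrices (i.e. U is a double potential). Then for every vector x ∈ ℝⁿ one has ⟨(Ux − 𝟙)⁺, x⟩ ≥ 0. -/
open Matrix Finset

/-- A nonnegative nonsingular matrix `U` is a potential if `M = U⁻¹` satisfies
`M i j ≤ 0` for `i ≠ j`, `M i i > 0`, and row diagonal dominance. -/
def IsPotential {n : ℕ} (U : Matrix (Fin n) (Fin n) ℝ) : Prop :=
  (∀ i j, 0 ≤ U i j) ∧ IsUnit U.det ∧
    (∀ i j, i ≠ j → U⁻¹ i j ≤ 0) ∧ (∀ i, 0 < U⁻¹ i i) ∧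
    (∀ i, ∑ j ∈ Finset.univ.erase i, |U⁻¹ i j| ≤ U⁻¹ i i)

theorem IsPotential.sum_row_inv_nonneg {n : ℕ} {U : Matrix (Fin n) (Fin n) ℝ}
    (h : IsPotential U) (i : Fin n) : 0 ≤ ∑ j, U⁻¹ i j := by
  obtain ⟨-, -, -, -, hdom⟩ := h
  have h1 := (Finset.abs_sum_le_sum_abs (fun j => U⁻¹ i j) (univ.erase i)).trans (hdom i)
  rw [← Finset.add_sum_erase univ (fun j => U⁻¹ i j) (mem_univ i)]
  linarith [neg_le_of_abs_le h1]

theorem IsPotential.sum_col_inv_nonneg {n : ℕ} {U : Matrix (Fin n) (Fin n) ℝ}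
    (h : IsPotential Uᵀ) (j : Fin n) : 0 ≤ ∑ i, U⁻¹ i j := by
  simpa [← Matrix.transpose_nonsing_inv] using h.sum_row_inv_nonneg j

/-- If `U` is a double potential, then `⟨(Ux − 𝟙)⁺, x⟩ ≥ 0` for all `x`. -/
theorem stmt_1 {n : ℕ} (U : Matrix (Fin n) (Fin n) ℝ)
    (hU : ∀ i j, 0 ≤ U i j) (hns : IsUnit U.det)
    (hpot : IsPotential U) (hpotT : IsPotential Uᵀ) :
    ∀ x : Fin n → ℝ, 0 ≤ ∑ i, max (U.mulVec x i - 1) 0 * x i := by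
  intro x
  set y := U.mulVec x with hy
  set w : Fin n → ℝ := fun i => max (y i - 1) 0 with hw
  have hx : ∀ i, x i = ∑ j, U⁻¹ i j * y j := fun i => by
    have hinv : U⁻¹ *ᵥ y = x := by
      rw [hy, Matrix.mulVec_mulVec, Matrix.nonsing_inv_mul U hns, Matrix.one_mulVec]
    exact (congrFun hinv i).symm
  have hw0 : ∀ i, 0 ≤ w i := fun i => le_max_right _ _
  have hyw : ∀ i, y i ≤ w i + 1 := fun i => by
    linarith [show y i - 1 ≤ w i from le_max_left _ _]
  have hwy : ∀ i, w i * y i = w i * (w i + 1) := fun i => by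
    rcases max_cases (y i - 1) 0 with h | h <;> simp [hw, h.1]
  have hterm : ∀ i j, U⁻¹ i j * ((w i ^ 2 + w j ^ 2) / 2 + w i) ≤ w i * (U⁻¹ i j * y j) := by
    intro i j
    rcases eq_or_ne i j with rfl | hij
    · exact le_of_eq (by linear_combination -U⁻¹ i i * hwy i)
    · have h1 : w i * y j ≤ (w i ^ 2 + w j ^ 2) / 2 + w i := by
        nlinarith [mul_le_mul_of_nonneg_left (hyw j) (hw0 i), sq_nonneg (w i - w j)]
      linarith [mul_le_mul_of_nonpos_left h1 (hpot.2.2.1 i j hij)]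
  calc 0 ≤ ∑ i, (w i ^ 2 / 2 + w i) * ∑ j, U⁻¹ i j + ∑ j, w j ^ 2 / 2 * ∑ i, U⁻¹ i j :=
        add_nonneg
          (sum_nonneg fun i _ => mul_nonneg (add_nonneg (by positivity) (hw0 i))
            (hpot.sum_row_inv_nonneg i))
          (sum_nonneg fun j _ => mul_nonneg (by positivity) (hpotT.sum_col_inv_nonneg j))
    _ = ∑ i, ∑ j, U⁻¹ i j * ((w i ^ 2 + w j ^ 2) / 2 + w i) := by
        simp only [mul_sum]
        rw [sum_comm (f := fun j i => w j ^ 2 / 2 * U⁻¹ i j)]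
        simp only [← sum_add_distrib]
        exact sum_congr rfl fun i _ => sum_congr rfl fun j _ => by ring
    _ ≤ ∑ i, ∑ j, w i * (U⁻¹ i j * y j) :=
        sum_le_sum fun i _ => sum_le_sum fun j _ => hterm i j
    _ = ∑ i, w i * x i := by simp only [hx, mul_sum]
end

section
/- Let U be a nonnegative nonsingular symmetric real n×n matrix. Then U is a potential matrix if and only if for every vector x ∈ ℝⁿ one has ⟨(Ux − 𝟙)⁺, x⟩ ≥ 0. -/
open Matrix Finset

/-- Diagonal dominance, given the sign pattern of the off-diagonal entries, says that the row sums
are nonnegative. -/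
theorem sum_abs_erase_le_diag_iff_of_offDiag_nonpos {ι : Type*} [Fintype ι] [DecidableEq ι]
    {M : Matrix ι ι ℝ} (hoff : ∀ i j, i ≠ j → M i j ≤ 0) (i : ι) :
    ∑ j ∈ univ.erase i, |M i j| ≤ M i i ↔ 0 ≤ ∑ j, M i j := by
  have h : ∑ j ∈ univ.erase i, |M i j| = -∑ j ∈ univ.erase i, M i j := by
    rw [← sum_neg_distrib]
    exact sum_congr rfl fun j hj => abs_of_nonpos (hoff i j (ne_of_mem_erase hj).symm)
  rw [h, ← add_sum_erase univ (M i) (mem_univ i)]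
  constructor <;> intro _ <;> linarith

/-- A symmetric matrix with nonpositive off-diagonal entries and nonnegative row sums satisfies
`⟨(y - 𝟙)⁺, M y⟩ ≥ 0` for all `y`. -/
theorem sum_max_sub_one_mul_mulVec_nonneg {ι : Type*} [Fintype ι]
    {M : Matrix ι ι ℝ} (hM : M.IsSymm) (hoff : ∀ i j, i ≠ j → M i j ≤ 0)
    (hrow : ∀ i, 0 ≤ ∑ j, M i j) (y : ι → ℝ) :
    0 ≤ ∑ i, max (y i - 1) 0 * M.mulVec y i := by
  set p : ι → ℝ := fun i => max (y i - 1) 0 with hp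
  have hp0 : ∀ i, 0 ≤ p i := fun i => le_max_right _ _
  have hyp : ∀ i, y i - 1 ≤ p i := fun i => le_max_left _ _
  have hswap : ∑ i, ∑ j, M i j * (p j ^ 2 / 2) = ∑ i, ∑ j, M i j * (p i ^ 2 / 2) := by
    rw [sum_comm]
    simp_rw [fun i j => hM.apply i j]
  have hterm : ∀ i j, M i j * (p i ^ 2 / 2) + M i j * (p j ^ 2 / 2) + M i j * p i
      ≤ p i * (M i j * y j) := by
    intro i j
    by_cases hij : i = j
    · subst hij
      have : p i * (y i - 1) = p i ^ 2 := by
        simp only [hp]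
        rcases le_total (y i - 1) 0 with h | h
        · simp [max_eq_right h]
        · rw [max_eq_left h]; ring
      linear_combination -M i i * this
    · have h : p i * (y j - 1) ≤ p i ^ 2 / 2 + p j ^ 2 / 2 := by
        nlinarith [mul_le_mul_of_nonneg_left (hyp j) (hp0 i), sq_nonneg (p i - p j)]
      nlinarith [mul_le_mul_of_nonpos_left h (hoff i j hij)]
  calc 0 ≤ ∑ i, (∑ j, M i j) * (p i ^ 2 + p i) :=
        sum_nonneg fun i _ => mul_nonneg (hrow i) (by have := hp0 i; positivity)
    _ = ∑ i, ∑ j, (M i j * (p i ^ 2 / 2) + M i j * (p j ^ 2 / 2) + M i j * p i) := by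
        simp_rw [sum_add_distrib]
        rw [hswap, ← sum_add_distrib, ← sum_add_distrib]
        refine sum_congr rfl fun i _ => ?_
        simp_rw [← sum_mul]
        ring
    _ ≤ ∑ i, ∑ j, p i * (M i j * y j) :=
        sum_le_sum fun i _ => sum_le_sum fun j _ => hterm i j
    _ = ∑ i, p i * M.mulVec y i := by
        simp_rw [mulVec, dotProduct, mul_sum]

/-- Testing `⟨(y - 𝟙)⁺, M y⟩ ≥ 0` on `y = 𝟙 + t eᵢ - s eⱼ`. -/
theorem nonneg_of_sum_max_sub_one_mul_mulVec_nonneg {ι : Type*} [Fintype ι] [DecidableEq ι]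
    {M : Matrix ι ι ℝ} (h : ∀ y : ι → ℝ, 0 ≤ ∑ i, max (y i - 1) 0 * M.mulVec y i)
    {i j : ι} (hij : i ≠ j) {t s : ℝ} (ht : 0 < t) (hs : 0 ≤ s) :
    0 ≤ t * M i i - s * M i j + ∑ k, M i k := by
  have key := h (1 + Pi.single i t - Pi.single j s)
  rw [sum_eq_single i] at key
  · have hi : M.mulVec (1 + Pi.single i t - Pi.single j s) i
        = t * M i i - s * M i j + ∑ k, M i k := by
      simp only [mulVec_sub, mulVec_add, mulVec_single, Pi.sub_apply, Pi.add_apply]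
      simp [mulVec, dotProduct]
      ring
    rw [hi] at key
    simp only [Pi.sub_apply, Pi.add_apply, Pi.one_apply, Pi.single_eq_same,
      Pi.single_eq_of_ne hij, sub_zero, add_sub_cancel_left, max_eq_left ht.le] at key
    exact nonneg_of_mul_nonneg_right key ht
  · intro k _ hk
    have : max ((1 + Pi.single i t - Pi.single j s : ι → ℝ) k - 1) 0 = 0 := by
      apply max_eq_right
      simp only [Pi.sub_apply, Pi.add_apply, Pi.one_apply, Pi.single_eq_of_ne hk]
      have : 0 ≤ (Pi.single j s : ι → ℝ) k := by
        by_cases hkj : k = j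
        · subst hkj; simpa using hs
        · simp [hkj]
      linarith
    rw [this, zero_mul]
  · simp

/-- Testing `⟨(y - 𝟙)⁺, M y⟩ ≥ 0` on `y = 𝟙 + t eᵢ`. -/
theorem row_sum_nonneg_of_sum_max_sub_one_mul_mulVec_nonneg {ι : Type*} [Fintype ι]
    [DecidableEq ι] {M : Matrix ι ι ℝ}
    (h : ∀ y : ι → ℝ, 0 ≤ ∑ i, max (y i - 1) 0 * M.mulVec y i) (i : ι) :
    0 ≤ ∑ k, M i k := by
  have key : ∀ t : ℝ, 0 < t → 0 ≤ t * M i i + ∑ k, M i k := by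
    intro t ht
    have key := h (1 + Pi.single i t)
    rw [sum_eq_single i] at key
    · have hi : M.mulVec (1 + Pi.single i t) i = t * M i i + ∑ k, M i k := by
        simp only [mulVec_add, mulVec_single, Pi.add_apply]
        simp [mulVec, dotProduct]
        ring
      rw [hi] at key
      simp only [Pi.add_apply, Pi.one_apply, Pi.single_eq_same,
        add_sub_cancel_left, max_eq_left ht.le] at key
      exact nonneg_of_mul_nonneg_right key ht
    · intro k _ hk
      simp [Pi.single_eq_of_ne hk]
    · simp
  by_contra! hneg
  have hpos : 0 < |M i i| + 1 := by positivity
  have := key (-(∑ k, M i k) / (2 * (|M i i| + 1))) (by apply div_pos <;> linarith)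
  have hle : -(∑ k, M i k) / (2 * (|M i i| + 1)) * M i i ≤ -(∑ k, M i k) / 2 := by
    rw [div_mul_eq_mul_div, div_le_div_iff₀ (by positivity) two_pos]
    nlinarith [le_abs_self (M i i)]
  linarith

/-- A nonnegative nonsingular symmetric matrix `U` is a potential iff
`⟨(Ux − 𝟙)⁺, x⟩ ≥ 0` for all `x`. -/
theorem stmt_2 {n : ℕ} (U : Matrix (Fin n) (Fin n) ℝ)
    (hU : ∀ i j, 0 ≤ U i j) (hns : IsUnit U.det) (hsym : Uᵀ = U) :
    IsPotential U ↔ ∀ x : Fin n → ℝ, 0 ≤ ∑ i, max (U.mulVec x i - 1) 0 * x i := by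
  constructor
  · rintro ⟨-, -, hoff, -, hdom⟩ x
    have hM : (U⁻¹).IsSymm := by
      rw [IsSymm, transpose_nonsing_inv, hsym]
    have := sum_max_sub_one_mul_mulVec_nonneg hM hoff
      (fun i => (sum_abs_erase_le_diag_iff_of_offDiag_nonpos hoff i).1 (hdom i)) (U.mulVec x)
    simpa only [mulVec_mulVec, nonsing_inv_mul U hns, one_mulVec] using this
  · intro hx
    have h : ∀ y : Fin n → ℝ, 0 ≤ ∑ i, max (y i - 1) 0 * (U⁻¹).mulVec y i := by
      intro y
      have := hx ((U⁻¹).mulVec y)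
      simpa only [mulVec_mulVec, mul_nonsing_inv U hns, one_mulVec] using this
    have hoff : ∀ i j, i ≠ j → U⁻¹ i j ≤ 0 := by
      intro i j hij
      by_contra! hpos
      have hs : 0 ≤ (|U⁻¹ i i + ∑ k, U⁻¹ i k| + 1) / U⁻¹ i j := by positivity
      have key := nonneg_of_sum_max_sub_one_mul_mulVec_nonneg h hij one_pos hs
      rw [div_mul_cancel₀ _ hpos.ne'] at key
      linarith [le_abs_self (U⁻¹ i i + ∑ k, U⁻¹ i k)]
    have hdom : ∀ i, ∑ j ∈ Finset.univ.erase i, |U⁻¹ i j| ≤ U⁻¹ i i := fun i =>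
      (sum_abs_erase_le_diag_iff_of_offDiag_nonpos hoff i).2
        (row_sum_nonneg_of_sum_max_sub_one_mul_mulVec_nonneg h i)
    refine ⟨hU, hns, hoff, fun i => ?_, hdom⟩
    have hnn : 0 ≤ ∑ j ∈ univ.erase i, |U⁻¹ i j| := sum_nonneg fun j _ => abs_nonneg _
    refine lt_of_le_of_ne (hnn.trans (hdom i)) fun hzero => ?_
    have hsum : ∑ j ∈ univ.erase i, |U⁻¹ i j| = 0 :=
      le_antisymm ((hdom i).trans hzero.ge) hnn
    have hrow : ∀ j, U⁻¹ i j = 0 := by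
      intro j
      by_cases hij : j = i
      · rw [hij, ← hzero]
      · exact abs_eq_zero.1 ((sum_eq_zero_iff_of_nonneg fun j _ => abs_nonneg _).1 hsum j
          (mem_erase.2 ⟨hij, mem_univ j⟩))
    exact (isUnit_nonsing_inv_det U hns).ne_zero (det_eq_zero_of_row_eq_zero i hrow)
end

section
/- Let U be a nonsingular nonnegative real n×n matrix with all row sums and all column sums positive. Let D be the diagonal matrix with D_{ii} = (Σ_j U_{ij})⁻¹ and E the diagonal matrix with E_{ii} = (Σ_j U_{ji})⁻¹. Then U⁻¹ is an M-matrix if and only if for every x ∈ ℝⁿ one has ⟨(Ux − D⁻¹𝟙)⁺, D E⁻¹ x⟩ ≥ 0. -/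
open Matrix Finset

/-- A nonsingular matrix `M` is an M-matrix if its off-diagonal entries are
nonpositive and its inverse is nonnegative. -/
def IsMMatrix {n : ℕ} (M : Matrix (Fin n) (Fin n) ℝ) : Prop :=
  IsUnit M.det ∧ (∀ i j, i ≠ j → M i j ≤ 0) ∧ (∀ i j, 0 ≤ M⁻¹ i j)

/-- A matrix with nonpositive off-diagonal entries and nonnegative row and column sums has a
nonnegative quadratic form. -/
theorem quadraticForm_nonneg_of_rowSum_colSum_nonneg {ι : Type*} [Fintype ι]
    (B : Matrix ι ι ℝ) (hB : ∀ i j, i ≠ j → B i j ≤ 0)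
    (hrow : ∀ i, 0 ≤ ∑ j, B i j) (hcol : ∀ j, 0 ≤ ∑ i, B i j) (z : ι → ℝ) :
    0 ≤ ∑ i, ∑ j, B i j * (z i * z j) := by
  have hsplit : ∑ i, ∑ j, B i j * ((z i ^ 2 + z j ^ 2) / 2) =
      (∑ i, z i ^ 2 * ∑ j, B i j) / 2 + (∑ j, z j ^ 2 * ∑ i, B i j) / 2 := by
    simp only [Finset.mul_sum, Finset.sum_div]
    rw [Finset.sum_comm (f := fun j i => z j ^ 2 * B i j / 2)]
    simp only [← Finset.sum_add_distrib]
    exact Finset.sum_congr rfl fun i _ => Finset.sum_congr rfl fun j _ => by ring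
  have hnonneg : 0 ≤ ∑ i, ∑ j, B i j * ((z i ^ 2 + z j ^ 2) / 2) := by
    rw [hsplit]
    have h₁ : 0 ≤ ∑ i, z i ^ 2 * ∑ j, B i j :=
      Finset.sum_nonneg fun i _ => mul_nonneg (sq_nonneg _) (hrow i)
    have h₂ : 0 ≤ ∑ j, z j ^ 2 * ∑ i, B i j :=
      Finset.sum_nonneg fun j _ => mul_nonneg (sq_nonneg _) (hcol j)
    positivity
  refine hnonneg.trans (Finset.sum_le_sum fun i _ => Finset.sum_le_sum fun j _ => ?_)
  rcases eq_or_ne i j with rfl | hij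
  · exact le_of_eq (by ring)
  · exact mul_le_mul_of_nonpos_left (by nlinarith [sq_nonneg (z i - z j)]) (hB i j hij)

/-- If `A` has nonpositive off-diagonal entries, and `A *ᵥ r` and `r ᵥ* A` are nonnegative for some
positive vector `r`, then `⟨w⁺, A w⟩ ≥ 0` for all `w`. -/
theorem sum_posPart_mul_mulVec_nonneg {ι : Type*} [Fintype ι]
    (A : Matrix ι ι ℝ) (hA : ∀ i j, i ≠ j → A i j ≤ 0) (r : ι → ℝ) (hr : ∀ i, 0 < r i)
    (hrow : ∀ i, 0 ≤ (A.mulVec r) i) (hcol : ∀ j, 0 ≤ (Matrix.vecMul r A) j) (w : ι → ℝ) :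
    0 ≤ ∑ i, max (w i) 0 * (A.mulVec w) i := by
  have hquad := quadraticForm_nonneg_of_rowSum_colSum_nonneg
    (Matrix.of fun i j => r i * A i j * r j)
    (fun i j hij => mul_nonpos_of_nonpos_of_nonneg
      (mul_nonpos_of_nonneg_of_nonpos (hr i).le (hA i j hij)) (hr j).le)
    (fun i => by
      simpa only [Matrix.of_apply, mul_assoc, ← Finset.mul_sum, Matrix.mulVec, dotProduct] using
        mul_nonneg (hr i).le (hrow i))
    (fun j => by
      simpa only [Matrix.of_apply, ← Finset.sum_mul, Matrix.vecMul, dotProduct] using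
        mul_nonneg (hcol j) (hr j).le)
    (fun i => max (w i) 0 / r i)
  refine hquad.trans (Finset.sum_le_sum fun i _ => ?_)
  rw [Matrix.mulVec, dotProduct, Finset.mul_sum]
  refine Finset.sum_le_sum fun j _ => ?_
  have hri := (hr i).ne'
  have hrj := (hr j).ne'
  have hcancel : r i * A i j * r j * (max (w i) 0 / r i * (max (w j) 0 / r j)) =
      max (w i) 0 * (A i j * max (w j) 0) := by
    field_simp
  rw [Matrix.of_apply, hcancel]
  rcases eq_or_ne i j with rfl | hij
  · rcases le_total (w i) 0 with h | h <;> simp [h]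
  · exact mul_le_mul_of_nonneg_left
      (mul_le_mul_of_nonpos_left (le_max_left _ _) (hA i j hij)) (le_max_right _ _)

/-- `U⁻¹` is an M-matrix iff `⟨(Ux − D⁻¹𝟙)⁺, D E⁻¹ x⟩ ≥ 0` for all `x`,
where `D` (resp. `E`) is the diagonal matrix of reciprocals of row (resp. column)
sums of `U`. -/
theorem stmt_5 {n : ℕ} (U : Matrix (Fin n) (Fin n) ℝ)
    (hU : ∀ i j, 0 ≤ U i j) (hns : IsUnit U.det)
    (hrow : ∀ i, 0 < ∑ j, U i j) (hcol : ∀ i, 0 < ∑ j, U j i)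
    (D E : Matrix (Fin n) (Fin n) ℝ)
    (hD : D = Matrix.diagonal fun i => (∑ j, U i j)⁻¹)
    (hE : E = Matrix.diagonal fun i => (∑ j, U j i)⁻¹) :
    IsMMatrix U⁻¹ ↔
      ∀ x : Fin n → ℝ,
        0 ≤ ∑ i, max (U.mulVec x i - D⁻¹.mulVec (fun _ => 1) i) 0 *
          (D * E⁻¹).mulVec x i := by
  set r : Fin n → ℝ := fun i => ∑ j, U i j with hr
  set c : Fin n → ℝ := fun i => ∑ j, U j i with hc
  have hr₀ : ∀ i, r i ≠ 0 := fun i => (hrow i).ne'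
  have hc₀ : ∀ i, c i ≠ 0 := fun i => (hcol i).ne'
  have hDinv : D⁻¹ = Matrix.diagonal r := by
    refine Matrix.inv_eq_right_inv ?_
    rw [hD, Matrix.diagonal_mul_diagonal, ← Matrix.diagonal_one]
    exact congrArg _ (funext fun i => inv_mul_cancel₀ (hr₀ i))
  have hEinv : E⁻¹ = Matrix.diagonal c := by
    refine Matrix.inv_eq_right_inv ?_
    rw [hE, Matrix.diagonal_mul_diagonal, ← Matrix.diagonal_one]
    exact congrArg _ (funext fun i => inv_mul_cancel₀ (hc₀ i))
  have hUone : U.mulVec 1 = r := funext fun i => by simp [Matrix.mulVec, dotProduct, hr]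
  have honeU : Matrix.vecMul 1 U = c := funext fun i => by simp [Matrix.vecMul, dotProduct, hc]
  have hinvr : U⁻¹.mulVec r = 1 := by
    rw [← hUone, Matrix.mulVec_mulVec, Matrix.nonsing_inv_mul U hns, Matrix.one_mulVec]
  have hcinv : Matrix.vecMul c U⁻¹ = 1 := by
    rw [← honeU, Matrix.vecMul_vecMul, Matrix.mul_nonsing_inv U hns, Matrix.vecMul_one]
  have hform : ∀ x : Fin n → ℝ,
      ∑ i, max (U.mulVec x i - D⁻¹.mulVec (fun _ => 1) i) 0 * (D * E⁻¹).mulVec x i =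
        ∑ i, max (U.mulVec x i - r i) 0 * (c i / r i * x i) := by
    intro x
    refine Finset.sum_congr rfl fun i _ => ?_
    rw [hDinv, hEinv, hD, Matrix.diagonal_mul_diagonal, Matrix.mulVec_diagonal,
      Matrix.mulVec_diagonal, mul_one, div_eq_inv_mul]
  simp only [hform]
  constructor
  · rintro ⟨-, hoff, -⟩ x
    set w : Fin n → ℝ := fun i => U.mulVec x i - r i
    have hinvw : U⁻¹.mulVec w = x - 1 := by
      have : w = U.mulVec x - r := rfl
      rw [this, Matrix.mulVec_sub, hinvr, Matrix.mulVec_mulVec, Matrix.nonsing_inv_mul U hns,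
        Matrix.one_mulVec]
    have hpos : ∀ i, 0 < c i / r i := fun i => div_pos (hcol i) (hrow i)
    have hscale : ∀ v : Fin n → ℝ, ∀ i,
        ((Matrix.diagonal fun i => c i / r i) * U⁻¹).mulVec v i =
          c i / r i * U⁻¹.mulVec v i := by
      intro v i
      rw [← Matrix.mulVec_mulVec, Matrix.mulVec_diagonal]
    have hmain := sum_posPart_mul_mulVec_nonneg ((Matrix.diagonal fun i => c i / r i) * U⁻¹)
      (fun i j hij => by
        rw [Matrix.diagonal_mul]
        exact mul_nonpos_of_nonneg_of_nonpos (hpos i).le (hoff i j hij))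
      r hrow
      (fun i => by
        rw [hscale, hinvr, Pi.one_apply, mul_one]
        exact (hpos i).le)
      (fun j => by
        have hrc : Matrix.vecMul r (Matrix.diagonal fun i => c i / r i) = c := funext fun i => by
          rw [Matrix.vecMul_diagonal, mul_div_cancel₀ _ (hr₀ i)]
        rw [← Matrix.vecMul_vecMul, hrc, hcinv, Pi.one_apply]
        exact zero_le_one)
      w
    refine hmain.trans (Finset.sum_le_sum fun i _ => ?_)
    rw [hscale, hinvw]
    refine mul_le_mul_of_nonneg_left (mul_le_mul_of_nonneg_left ?_ (hpos i).le) (le_max_right _ _)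
    simp
  · intro h
    refine ⟨(Matrix.isUnit_nonsing_inv_det_iff).2 hns, fun i j hij => ?_, fun i j => ?_⟩
    · by_contra! hlt
      set t : ℝ := (|U⁻¹ i i| + 2) / U⁻¹ i j
      have ht₀ : 0 ≤ t := by positivity
      have htM : U⁻¹ i j * t = |U⁻¹ i i| + 2 := mul_div_cancel₀ _ hlt.ne'
      set w : Fin n → ℝ := Pi.single i 1 - Pi.single j t with hw
      have hUx : U.mulVec (1 + U⁻¹.mulVec w) = r + w := by
        rw [Matrix.mulVec_add, hUone, Matrix.mulVec_mulVec, Matrix.mul_nonsing_inv U hns,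
          Matrix.one_mulVec]
      have hx := h (1 + U⁻¹.mulVec w)
      rw [hUx, Finset.sum_eq_single i] at hx
      · have hwi : w i = 1 := by simp [hw, hij]
        have hMw : U⁻¹.mulVec w i = U⁻¹ i i - U⁻¹ i j * t := by
          simp [hw, Matrix.mulVec_sub, Matrix.mulVec_single, mul_comm]
        simp only [Pi.add_apply, add_sub_cancel_left, hwi, Pi.one_apply, hMw, htM,
          max_eq_left zero_le_one, one_mul] at hx
        have hneg : 1 + (U⁻¹ i i - (|U⁻¹ i i| + 2)) < 0 := by linarith [le_abs_self (U⁻¹ i i)]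
        exact (mul_neg_of_pos_of_neg (div_pos (hcol i) (hrow i)) hneg).not_ge hx
      · intro k _ hk
        have hwk : w k ≤ 0 := by
          rcases eq_or_ne k j with rfl | hkj
          · simpa [hw, hk] using ht₀
          · simp [hw, hk, hkj]
        simp [hwk]
      · simp
    · rw [Matrix.nonsing_inv_nonsing_inv U hns]
      exact hU i j
end

section
/- Let M be a real n×n matrix such that for every x ∈ ℝⁿ one has ⟨(x − 𝟙)⁺, Mx⟩ ≥ 0. Then M satisfies: M_{ij} ≤ 0 for all i ≠ j, M_{ii} ≥ 0 for all i, and M_{ii} ≥ Σ_{j≠i} (−M_{ij}) for all i; that is, M is a Z-matrix with nonnegative diagonal which is row diagonally dominant. -/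
open Matrix Finset

/-- Testing the inequality on a vector whose only entry above `1` is the `i`-th one. -/
lemma row_nonneg_of_le_one {n : ℕ} (M : Matrix (Fin n) (Fin n) ℝ)
    (h : ∀ x : Fin n → ℝ, 0 ≤ ∑ i, max (x i - 1) 0 * M.mulVec x i)
    (i : Fin n) (y : Fin n → ℝ) (hy : ∀ j, y j ≤ 1) {e : ℝ} (he : 0 < e) :
    0 ≤ M i i * (1 + e) + ∑ j ∈ Finset.univ.erase i, M i j * y j := by
  have hx := h (Function.update y i (1 + e))
  rw [Finset.sum_eq_single i] at hx
  · have hmax : max (Function.update y i (1 + e) i - 1) 0 = e := by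
      simp [he.le]
    rw [hmax] at hx
    have hrow := nonneg_of_mul_nonneg_right hx he
    rw [Matrix.mulVec, dotProduct, ← Finset.add_sum_erase _ _ (Finset.mem_univ i)] at hrow
    rw [Function.update_self] at hrow
    refine hrow.trans_eq ?_
    congr 1
    refine Finset.sum_congr rfl fun j hj => ?_
    rw [Function.update_of_ne (Finset.ne_of_mem_erase hj)]
  · intro j _ hj
    rw [Function.update_of_ne hj, max_eq_right (by linarith [hy j]), zero_mul]
  · simp

/-- If `⟨(x − 𝟙)⁺, Mx⟩ ≥ 0` for all `x`, then `M` is a Z-matrix with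
nonnegative diagonal which is row diagonally dominant. -/
theorem stmt_8 {n : ℕ} (M : Matrix (Fin n) (Fin n) ℝ)
    (h : ∀ x : Fin n → ℝ, 0 ≤ ∑ i, max (x i - 1) 0 * M.mulVec x i) :
    (∀ i j, i ≠ j → M i j ≤ 0) ∧ (∀ i, 0 ≤ M i i) ∧
      (∀ i, ∑ j ∈ Finset.univ.erase i, (-M i j) ≤ M i i) := by
  have key := row_nonneg_of_le_one M h
  have diag : ∀ i, 0 ≤ M i i := fun i => by
    have := key i 0 (fun _ => zero_le_one) one_pos
    simp only [Pi.zero_apply, mul_zero, Finset.sum_const_zero] at this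
    linarith
  refine ⟨fun i j hij => ?_, diag, fun i => ?_⟩
  · by_contra! hpos
    have ht : 0 ≤ (2 * M i i + 1) / M i j :=
      div_nonneg (by linarith [diag i]) hpos.le
    have hrow := key i (Pi.single j (-((2 * M i i + 1) / M i j)))
      (fun k => by
        by_cases hk : k = j
        · subst hk
          rw [Pi.single_eq_same]
          linarith
        · simp [hk]) one_pos
    rw [Finset.sum_eq_single j (fun k _ hk => by simp [hk])
      (fun hj => absurd (Finset.mem_erase.2 ⟨hij.symm, Finset.mem_univ j⟩) hj),
      Pi.single_eq_same, mul_neg, mul_div_cancel₀ _ hpos.ne'] at hrow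
    linarith
  · rw [Finset.sum_neg_distrib]
    by_contra! hlt
    set S := ∑ j ∈ Finset.univ.erase i, M i j with hS
    have hd : 0 < M i i + 1 := by linarith [diag i]
    have he : 0 < (-S - M i i) / (M i i + 1) / 2 :=
      half_pos (div_pos (by linarith) hd)
    have hrow := key i 1 (fun _ => le_rfl) he
    simp only [Pi.one_apply, mul_one, ← hS] at hrow
    have hcancel : (M i i + 1) * ((-S - M i i) / (M i i + 1) / 2) = (-S - M i i) / 2 := by
      field_simp
    linarith
end

section
/- Let M be a real n×n matrix such that M_{ij} ≤ 0 for all i ≠ j, M_{ii} ≥ 0 for all i, M_{ii} ≥ Σ_{j≠i} (−M_{ij}) for all i (row diagonal dominance), and M_{ii} ≥ Σ_{j≠i} (−M_{ji}) for all i (column diagonal dominance). Then for every x ∈ ℝⁿ one has ⟨(x − 𝟙)⁺, Mx⟩ ≥ 0. -/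
open Matrix Finset

/-- If `M` is a Z-matrix with nonnegative diagonal which is row and
column diagonally dominant, then `⟨(x − 𝟙)⁺, Mx⟩ ≥ 0` for all `x`. -/
theorem stmt_9 {n : ℕ} (M : Matrix (Fin n) (Fin n) ℝ)
    (hoff : ∀ i j, i ≠ j → M i j ≤ 0) (hdiag : ∀ i, 0 ≤ M i i)
    (hrow : ∀ i, ∑ j ∈ Finset.univ.erase i, (-M i j) ≤ M i i)
    (hcol : ∀ i, ∑ j ∈ Finset.univ.erase i, (-M j i) ≤ M i i) :
    ∀ x : Fin n → ℝ, 0 ≤ ∑ i, max (x i - 1) 0 * M.mulVec x i := by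
  intro x
  have row_nonneg : ∀ i, 0 ≤ ∑ j, M i j := fun i => by
    have h := hrow i
    rw [Finset.sum_neg_distrib] at h
    rw [← Finset.add_sum_erase _ _ (Finset.mem_univ i)]
    linarith
  have col_nonneg : ∀ j, 0 ≤ ∑ i, M i j := fun j => by
    have h := hcol j
    rw [Finset.sum_neg_distrib] at h
    rw [← Finset.add_sum_erase _ _ (Finset.mem_univ j)]
    linarith
  set y : Fin n → ℝ := fun i => max (x i - 1) 0 with hy
  have y_nonneg : ∀ i, 0 ≤ y i := fun i => le_max_right _ _
  have x_le : ∀ i, x i ≤ 1 + y i := fun i => by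
    have : x i - 1 ≤ y i := le_max_left _ _
    linarith
  have entry_le : ∀ i j,
      M i j * (y i + y i ^ 2 / 2) + M i j * (y j ^ 2 / 2) ≤ y i * (M i j * x j) := by
    intro i j
    by_cases hij : i = j
    · subst hij
      have hyx : y i * x i = y i * (1 + y i) := by
        rcases max_choice (x i - 1) 0 with h | h
        · have : y i = x i - 1 := h
          rw [this]; ring
        · have : y i = 0 := h
          rw [this]; ring
      apply le_of_eq
      linear_combination -M i i * hyx
    · have hle : y i * x j ≤ y i + y i ^ 2 / 2 + y j ^ 2 / 2 := by
        nlinarith [mul_le_mul_of_nonneg_left (x_le j) (y_nonneg i), sq_nonneg (y i - y j)]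
      linarith [mul_le_mul_of_nonpos_left hle (hoff i j hij)]
  calc (0 : ℝ) ≤ ∑ i, (∑ j, M i j) * (y i + y i ^ 2 / 2)
        + ∑ j, (∑ i, M i j) * (y j ^ 2 / 2) := by
        refine add_nonneg (Finset.sum_nonneg fun i _ => mul_nonneg (row_nonneg i) ?_)
          (Finset.sum_nonneg fun j _ => mul_nonneg (col_nonneg j) (by positivity))
        have := y_nonneg i
        positivity
    _ = ∑ i, ∑ j, (M i j * (y i + y i ^ 2 / 2) + M i j * (y j ^ 2 / 2)) := by
        simp only [Finset.sum_add_distrib, Finset.sum_mul]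
        congr 1
        exact Finset.sum_comm
    _ ≤ ∑ i, ∑ j, y i * (M i j * x j) :=
        Finset.sum_le_sum fun i _ => Finset.sum_le_sum fun j _ => entry_le i j
    _ = ∑ i, y i * M.mulVec x i := by
        simp only [Matrix.mulVec, dotProduct, Finset.mul_sum]
end

section
/- Let U be a nonnegative nonsingular real n×n matrix. Then U satisfies the Complete Maximum Principle if and only if U is a potential, i.e. M = U⁻¹ satisfies M_{ij} ≤ 0 for all i ≠ j, M_{ii} > 0 for all i, and M_{ii} ≥ Σ_{j≠i} |M_{ij}| for all i. -/
open Matrix Finset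

/-- A matrix `U` satisfies the Complete Maximum Principle if, whenever `(Ux) i ≤ 1`
for all coordinates `i` with `x i ≥ 0`, then `Ux ≤ 𝟙`. -/
def SatisfiesCMP {n : ℕ} (U : Matrix (Fin n) (Fin n) ℝ) : Prop :=
  ∀ x : Fin n → ℝ, (∀ i, 0 ≤ x i → U.mulVec x i ≤ 1) → ∀ j, U.mulVec x j ≤ 1

theorem SatisfiesCMP.inv_mulVec_nonneg {n : ℕ} {U : Matrix (Fin n) (Fin n) ℝ}
    (h : SatisfiesCMP U) (hns : IsUnit U.det) {y : Fin n → ℝ} {i : Fin n}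
    (hi : 1 < y i) (hy : ∀ k, k ≠ i → y k ≤ 1) : 0 ≤ (U⁻¹ *ᵥ y) i := by
  by_contra! hneg
  have hUy : U *ᵥ (U⁻¹ *ᵥ y) = y := by
    rw [mulVec_mulVec, mul_nonsing_inv _ hns, one_mulVec]
  have key := h (U⁻¹ *ᵥ y) (fun k hk => by
    rw [hUy]
    exact hy k fun hki => absurd (hki ▸ hk) (not_le.mpr hneg)) i
  rw [hUy] at key
  linarith

theorem SatisfiesCMP.inv_apply_nonpos {n : ℕ} {U : Matrix (Fin n) (Fin n) ℝ}
    (h : SatisfiesCMP U) (hns : IsUnit U.det) {i j : Fin n} (hij : i ≠ j) :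
    U⁻¹ i j ≤ 0 := by
  have key : ∀ s : ℝ, 0 ≤ s → 0 ≤ U⁻¹ i i * 2 - U⁻¹ i j * s := fun s hs => by
    have := h.inv_mulVec_nonneg hns (y := Pi.single i 2 - Pi.single j s) (i := i)
      (by simp [hij]) (fun k hk => by
        by_cases hkj : k = j
        · subst hkj; simp [hk]; linarith
        · simp [hk, hkj])
    simpa [mulVec_sub, mul_comm] using this
  by_contra! hpos
  have h0 := key 0 le_rfl
  have h1 := key ((U⁻¹ i i * 2 + 1) / U⁻¹ i j) (div_nonneg (by linarith) hpos.le)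
  rw [mul_div_cancel₀ _ hpos.ne'] at h1
  linarith

theorem SatisfiesCMP.inv_row_sum_nonneg {n : ℕ} {U : Matrix (Fin n) (Fin n) ℝ}
    (h : SatisfiesCMP U) (hns : IsUnit U.det) (i : Fin n) : 0 ≤ ∑ j, U⁻¹ i j := by
  have key : ∀ ε : ℝ, 0 < ε → 0 ≤ ∑ j, U⁻¹ i j + ε * U⁻¹ i i := fun ε hε => by
    have := h.inv_mulVec_nonneg hns (y := 1 + Pi.single i ε) (i := i)
      (by simpa using hε) (fun k hk => by simp [hk])
    have hone : (U⁻¹ *ᵥ 1) i = ∑ j, U⁻¹ i j := by simp [mulVec, dotProduct]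
    rw [mulVec_add, Pi.add_apply, hone] at this
    simpa [mul_comm] using this
  by_contra! hneg
  rcases le_or_gt (U⁻¹ i i) 0 with hd | hd
  · have := key 1 one_pos
    linarith
  · have := key (-(∑ j, U⁻¹ i j) / (2 * U⁻¹ i i)) (div_pos (by linarith) (by linarith))
    have e : -(∑ j, U⁻¹ i j) / (2 * U⁻¹ i i) * U⁻¹ i i = -(∑ j, U⁻¹ i j) / 2 := by
      field_simp
    linarith

theorem sum_abs_erase_le_iff_sum_nonneg {n : ℕ} {M : Matrix (Fin n) (Fin n) ℝ}
    (hM : ∀ i j, i ≠ j → M i j ≤ 0) (i : Fin n) :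
    ∑ j ∈ Finset.univ.erase i, |M i j| ≤ M i i ↔ 0 ≤ ∑ j, M i j := by
  have habs : ∑ j ∈ Finset.univ.erase i, |M i j| = -∑ j ∈ Finset.univ.erase i, M i j := by
    rw [← Finset.sum_neg_distrib]
    exact Finset.sum_congr rfl fun j hj =>
      abs_of_nonpos (hM i j (Finset.ne_of_mem_erase hj).symm)
  rw [habs, ← Finset.add_sum_erase _ _ (Finset.mem_univ i)]
  constructor <;> intro h <;> linarith

theorem satisfiesCMP_of_inv {n : ℕ} {U : Matrix (Fin n) (Fin n) ℝ} (hns : IsUnit U.det)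
    (hoff : ∀ i j, i ≠ j → U⁻¹ i j ≤ 0) (hsum : ∀ i, 0 ≤ ∑ j, U⁻¹ i j) :
    SatisfiesCMP U := by
  intro x hx j
  obtain ⟨m, -, hm⟩ := Finset.exists_max_image Finset.univ (U *ᵥ x) ⟨j, Finset.mem_univ j⟩
  refine (hm j (Finset.mem_univ j)).trans ?_
  by_contra! hgt
  refine absurd (hx m ?_) (not_le.mpr hgt)
  have hxm : x m = ∑ k, U⁻¹ m k * (U *ᵥ x) k := by
    change x m = (U⁻¹ *ᵥ (U *ᵥ x)) m
    rw [mulVec_mulVec, nonsing_inv_mul _ hns, one_mulVec]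
  rw [hxm]
  calc 0 ≤ (∑ k, U⁻¹ m k) * (U *ᵥ x) m := mul_nonneg (hsum m) (by linarith)
    _ = ∑ k, U⁻¹ m k * (U *ᵥ x) m := Finset.sum_mul ..
    _ ≤ ∑ k, U⁻¹ m k * (U *ᵥ x) k := Finset.sum_le_sum fun k _ => by
      rcases eq_or_ne m k with rfl | hk
      · exact le_rfl
      · exact mul_le_mul_of_nonpos_left (hm k (Finset.mem_univ k)) (hoff m k hk)

/-- A nonnegative nonsingular matrix `U` satisfies the CMP iff `U` is a
potential, i.e. `M = U⁻¹` is a row diagonally dominant M-matrix. -/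
theorem stmt_10 {n : ℕ} (U : Matrix (Fin n) (Fin n) ℝ)
    (hU : ∀ i j, 0 ≤ U i j) (hns : IsUnit U.det) :
    SatisfiesCMP U ↔
      (∀ i j, i ≠ j → U⁻¹ i j ≤ 0) ∧ (∀ i, 0 < U⁻¹ i i) ∧
        (∀ i, ∑ j ∈ Finset.univ.erase i, |U⁻¹ i j| ≤ U⁻¹ i i) := by
  constructor
  · intro h
    have hoff : ∀ i j, i ≠ j → U⁻¹ i j ≤ 0 := fun i j => h.inv_apply_nonpos hns
    have hdom := fun i => (sum_abs_erase_le_iff_sum_nonneg hoff i).mpr (h.inv_row_sum_nonneg hns i)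
    refine ⟨hoff, fun i => ?_, hdom⟩
    by_contra! hle
    have habs : ∀ j ∈ Finset.univ.erase i, 0 ≤ |U⁻¹ i j| := fun j _ => abs_nonneg _
    have hzero : ∀ j, U⁻¹ i j = 0 := fun j => by
      rcases eq_or_ne j i with rfl | hj
      · exact le_antisymm hle ((Finset.sum_nonneg habs).trans (hdom j))
      · have := (Finset.single_le_sum habs (Finset.mem_erase.mpr ⟨hj, Finset.mem_univ j⟩)).trans
          ((hdom i).trans hle)
        exact abs_nonpos_iff.mp this
    exact (U.isUnit_nonsing_inv_det hns).ne_zero (det_eq_zero_of_row_eq_zero i hzero)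
  · rintro ⟨hoff, -, hdom⟩
    exact satisfiesCMP_of_inv hns hoff fun i => (sum_abs_erase_le_iff_sum_nonneg hoff i).mp (hdom i)
end

section
/- Let U be a nonnegative real n×n matrix satisfying the Complete Maximum Principle. Then for every a ≥ 0 the matrix U(a) = aI + U also satisfies the Complete Maximum Principle, and for every a > 0 the matrix U(a) is nonsingular. -/
open Matrix Finset

/-- Under the CMP, a vector with `U x = -a x` for some `a > 0` is nonnegative. -/
theorem SatisfiesCMP.nonneg_of_mulVec_eq_neg {n : ℕ} {U : Matrix (Fin n) (Fin n) ℝ}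
    (hcmp : SatisfiesCMP U) {a : ℝ} (ha : 0 < a) {x : Fin n → ℝ}
    (hx : ∀ i, U.mulVec x i = -(a * x i)) (j : Fin n) : 0 ≤ x j := by
  by_contra! hj
  have hpos : 0 < -(a * x j) := neg_pos.mpr (mul_neg_of_pos_of_neg ha hj)
  set t : ℝ := 2 / -(a * x j) with ht
  have htpos : 0 < t := by positivity
  have h := hcmp (t • x) (fun i hi => by
    have hi' : 0 ≤ x i := nonneg_of_mul_nonneg_right hi htpos
    have hnonneg : 0 ≤ t * (a * x i) := by positivity
    rw [Matrix.mulVec_smul, Pi.smul_apply, smul_eq_mul, hx]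
    linarith) j
  rw [Matrix.mulVec_smul, Pi.smul_apply, smul_eq_mul, hx, ht,
    div_mul_cancel₀ _ hpos.ne'] at h
  norm_num at h

/-- If a nonnegative matrix `U` satisfies the CMP, then `aI + U`
satisfies the CMP for every `a ≥ 0`, and `aI + U` is nonsingular for every `a > 0`. -/
theorem stmt_11 {n : ℕ} (U : Matrix (Fin n) (Fin n) ℝ)
    (hU : ∀ i j, 0 ≤ U i j) (hcmp : SatisfiesCMP U) :
    (∀ a : ℝ, 0 ≤ a → SatisfiesCMP (a • (1 : Matrix (Fin n) (Fin n) ℝ) + U)) ∧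
      (∀ a : ℝ, 0 < a → IsUnit (a • (1 : Matrix (Fin n) (Fin n) ℝ) + U).det) := by
  have happly : ∀ (a : ℝ) (x : Fin n → ℝ) (i : Fin n),
      (a • (1 : Matrix (Fin n) (Fin n) ℝ) + U).mulVec x i = a * x i + U.mulVec x i := by
    intro a x i
    simp [Matrix.add_mulVec, Matrix.smul_mulVec]
  refine ⟨fun a ha x hx j => ?_, fun a ha => ?_⟩
  · rcases le_or_gt 0 (x j) with hj | hj
    · exact hx j hj
    · have h : U.mulVec x j ≤ 1 := hcmp x (fun i hi => by
        have hxi := hx i hi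
        rw [happly] at hxi
        linarith [mul_nonneg ha hi]) j
      rw [happly]
      linarith [mul_nonpos_of_nonneg_of_nonpos ha hj.le]
  · rw [isUnit_iff_ne_zero]
    intro hdet
    obtain ⟨x, hx0, hx⟩ := Matrix.exists_mulVec_eq_zero_iff.mpr hdet
    have hker : ∀ i, U.mulVec x i = -(a * x i) := by
      intro i
      have hi := congrFun hx i
      rw [happly, Pi.zero_apply] at hi
      linarith
    refine hx0 (funext fun j => le_antisymm ?_ (hcmp.nonneg_of_mulVec_eq_neg ha hker j))
    have h := hcmp.nonneg_of_mulVec_eq_neg (x := -x) ha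
      (fun i => by simp [Matrix.mulVec_neg, hker]) j
    simpa using h
end

section
/- Let U be a nonnegative real n×n matrix with strictly positive diagonal entries that satisfies the Complete Maximum Principle. Then there exists a nonnegative vector μ ∈ ℝⁿ such that Uμ = 𝟙. -/
open Matrix Finset

open Filter Topology

/-- A vector `x` with `U x = -ε x` is nonnegative when `U` satisfies the CMP and `ε > 0`. -/
lemma SatisfiesCMP.nonneg_of_mulVec_eq {n : ℕ} {U : Matrix (Fin n) (Fin n) ℝ}
    (hcmp : SatisfiesCMP U) {ε : ℝ} (hε : 0 < ε) {x : Fin n → ℝ}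
    (hx : ∀ i, U.mulVec x i = -(ε * x i)) (j : Fin n) : 0 ≤ x j := by
  by_contra! hj
  have hpos : 0 < -(ε * x j) := by nlinarith
  have ht : 0 < 2 / -(ε * x j) := by positivity
  have h := hcmp ((2 / -(ε * x j)) • x) (fun i hi => by
    have hxi : 0 ≤ x i := nonneg_of_mul_nonneg_right (by simpa using hi) ht
    rw [mulVec_smul, Pi.smul_apply, smul_eq_mul, hx]
    have : 0 ≤ 2 / -(ε * x j) * (ε * x i) := by positivity
    linarith) j
  rw [mulVec_smul, Pi.smul_apply, smul_eq_mul, hx, div_mul_cancel₀ _ hpos.ne'] at h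
  norm_num at h

/-- If `U` satisfies the CMP and `ε > 0`, then `(U + ε I) μ = 𝟙` has a nonnegative solution. -/
lemma SatisfiesCMP.exists_nonneg_regularized {n : ℕ} {U : Matrix (Fin n) (Fin n) ℝ}
    (hcmp : SatisfiesCMP U) {ε : ℝ} (hε : 0 < ε) :
    ∃ μ : Fin n → ℝ, (∀ i, 0 ≤ μ i) ∧ ∀ i, U.mulVec μ i + ε * μ i = 1 := by
  have hinj : Function.Injective
      (U.mulVecLin + ε • LinearMap.id : (Fin n → ℝ) →ₗ[ℝ] (Fin n → ℝ)) := by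
    rw [injective_iff_map_eq_zero]
    intro x hx
    have hx' : ∀ i, U.mulVec x i = -(ε * x i) := fun i => by
      have := congrFun hx i
      simp only [LinearMap.add_apply, LinearMap.smul_apply, LinearMap.id_apply,
        mulVecLin_apply, Pi.add_apply, Pi.smul_apply, smul_eq_mul, Pi.zero_apply] at this
      linarith
    have hneg := hcmp.nonneg_of_mulVec_eq hε (x := -x) (fun i => by
      simp [mulVec_neg, hx' i])
    ext i
    have hi := hneg i
    rw [Pi.neg_apply] at hi
    exact le_antisymm (neg_nonneg.mp hi) (hcmp.nonneg_of_mulVec_eq hε hx' i)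
  obtain ⟨μ, hμ⟩ := LinearMap.surjective_of_injective hinj (fun _ => 1)
  have hμ' : ∀ i, U.mulVec μ i + ε * μ i = 1 := fun i => by simpa using congrFun hμ i
  refine ⟨μ, fun j => ?_, hμ'⟩
  have h := hcmp μ (fun i hi => by nlinarith [hμ' i, mul_nonneg hε.le hi]) j
  exact nonneg_of_mul_nonneg_right (by linarith [hμ' j]) hε

/-- If a nonnegative matrix `U` with strictly positive diagonal
satisfies the CMP, then there is a nonnegative vector `μ` with `Uμ = 𝟙`. -/
theorem stmt_12 {n : ℕ} (U : Matrix (Fin n) (Fin n) ℝ)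
    (hU : ∀ i j, 0 ≤ U i j) (hdiag : ∀ i, 0 < U i i) (hcmp : SatisfiesCMP U) :
    ∃ μ : Fin n → ℝ, (∀ i, 0 ≤ μ i) ∧ U.mulVec μ = fun _ => 1 := by
  choose μ hμ0 hμ using fun k : ℕ =>
    hcmp.exists_nonneg_regularized (Nat.one_div_pos_of_nat (α := ℝ) (n := k))
  have hmem : ∀ k, μ k ∈ Set.Icc (0 : Fin n → ℝ) (fun i => 1 / U i i) := fun k => by
    refine ⟨hμ0 k, fun i => ?_⟩
    rw [le_div_iff₀' (hdiag i)]
    have hle : U i i * μ k i ≤ U.mulVec (μ k) i :=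
      Finset.single_le_sum (f := fun j => U i j * μ k j)
        (fun j _ => mul_nonneg (hU i j) (hμ0 k j)) (mem_univ i)
    have hreg : 0 ≤ 1 / ((k : ℝ) + 1) * μ k i := mul_nonneg (by positivity) (hμ0 k i)
    linarith [hμ k i]
  obtain ⟨ν, hν, φ, hφ, hlim⟩ := isCompact_Icc.tendsto_subseq hmem
  refine ⟨ν, hν.1, funext fun i => ?_⟩
  have hcont : Continuous fun x : Fin n → ℝ => U.mulVec x i :=
    (continuous_apply i).comp (continuous_const.matrix_mulVec continuous_id)
  have hε := (tendsto_one_div_add_atTop_nhds_zero_nat (𝕜 := ℝ)).comp hφ.tendsto_atTop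
  have hsum := ((hcont.tendsto ν).comp hlim).add
    (hε.mul (((continuous_apply i).tendsto ν).comp hlim))
  rw [zero_mul, add_zero] at hsum
  exact tendsto_nhds_unique hsum
    (tendsto_const_nhds.congr fun k => (hμ (φ k) i).symm)
end

section
/- Let U be a nonnegative real n×n matrix (not necessarily nonsingular) such that for every x ∈ ℝⁿ one has ⟨(Ux − 𝟙)⁺, x⟩ ≥ 0. Then U satisfies the Complete Maximum Principle. -/
open Matrix Finset

/-- If a nonnegative matrix `U` (possibly singular) satisfies
`⟨(Ux − 𝟙)⁺, x⟩ ≥ 0` for all `x`, then `U` satisfies the CMP. -/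
theorem stmt_13 {n : ℕ} (U : Matrix (Fin n) (Fin n) ℝ)
    (hU : ∀ i j, 0 ≤ U i j)
    (h : ∀ x : Fin n → ℝ, 0 ≤ ∑ i, max (U.mulVec x i - 1) 0 * x i) :
    SatisfiesCMP U := by
  intro x hx j
  by_contra! hj
  have neg_of_gt : ∀ i, 1 < U.mulVec x i → x i < 0 := fun i hi => by
    by_contra! hxi
    exact (hx i hxi).not_gt hi
  refine (h x).not_gt (Finset.sum_neg' (fun i _ => ?_) ⟨j, Finset.mem_univ j, ?_⟩)
  · rcases le_or_gt (U.mulVec x i) 1 with hi | hi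
    · rw [max_eq_right (sub_nonpos.mpr hi), zero_mul]
    · exact mul_nonpos_of_nonneg_of_nonpos (le_max_right _ _) (neg_of_gt i hi).le
  · exact mul_neg_of_pos_of_neg (lt_max_of_lt_left (sub_pos.mpr hj)) (neg_of_gt j hj)
end

section
/- Let U be a nonnegative nonsingular real n×n matrix. Then U⁻¹ is an M-matrix if and only if U satisfies the Domination Principle. -/
open Matrix Finset

/-- A matrix `U` satisfies the Domination Principle if for all nonnegative `x, y`:
whenever `(Ux) i ≤ (Uy) i` for all coordinates `i` with `x i > 0`, then `Ux ≤ Uy`. -/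
def SatisfiesDP {n : ℕ} (U : Matrix (Fin n) (Fin n) ℝ) : Prop :=
  ∀ x y : Fin n → ℝ, (∀ i, 0 ≤ x i) → (∀ i, 0 ≤ y i) →
    (∀ i, 0 < x i → U.mulVec x i ≤ U.mulVec y i) → ∀ j, U.mulVec x j ≤ U.mulVec y j

/-- If `M` has nonpositive off-diagonal entries, `w` is nonnegative and `w i = 0`, then
`(M w) i` is nonpositive. -/
theorem mulVec_nonpos_of_offDiag_nonpos {n : ℕ} {M : Matrix (Fin n) (Fin n) ℝ}
    (hM : ∀ i j, i ≠ j → M i j ≤ 0) {w : Fin n → ℝ} (hw : ∀ j, 0 ≤ w j) {i : Fin n}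
    (hi : w i = 0) : (M *ᵥ w) i ≤ 0 := by
  simp only [mulVec, dotProduct]
  refine Finset.sum_nonpos fun j _ => ?_
  rcases eq_or_ne i j with rfl | hij
  · simp [hi]
  · exact mul_nonpos_of_nonpos_of_nonneg (hM i j hij) (hw j)

/-- The signed form of the Domination Principle: if `U z` is nonpositive wherever `z` is
positive, then `U z` is nonpositive. -/
theorem SatisfiesDP.mulVec_nonpos {n : ℕ} {U : Matrix (Fin n) (Fin n) ℝ} (h : SatisfiesDP U)
    {z : Fin n → ℝ} (hz : ∀ i, 0 < z i → (U *ᵥ z) i ≤ 0) (j : Fin n) : (U *ᵥ z) j ≤ 0 := by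
  have hsub : ∀ k, (U *ᵥ z) k = (U *ᵥ z⁺) k - (U *ᵥ z⁻) k := fun k => by
    rw [← Pi.sub_apply, ← mulVec_sub, posPart_sub_negPart]
  rw [hsub, sub_nonpos]
  refine h z⁺ z⁻ (posPart_nonneg z) (negPart_nonneg z) (fun i hi => ?_) j
  rw [← sub_nonpos, ← hsub]
  exact hz i (posPart_pos_iff.mp hi)

/-- The inverse of a nonsingular matrix satisfying the Domination Principle has nonpositive
off-diagonal entries. -/
theorem SatisfiesDP.inv_offDiag_nonpos {n : ℕ} {U : Matrix (Fin n) (Fin n) ℝ}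
    (h : SatisfiesDP U) (hns : IsUnit U.det) {i j : Fin n} (hij : i ≠ j) : U⁻¹ i j ≤ 0 := by
  by_contra! hpos
  let t := |U⁻¹ i i| / U⁻¹ i j
  have ht : 0 ≤ t := by positivity
  let p : Fin n → ℝ := Pi.single i 1 - t • Pi.single j 1
  have hUz : U *ᵥ (U⁻¹ *ᵥ p) = p := by
    rw [mulVec_mulVec, mul_nonsing_inv U hns, one_mulVec]
  have hzi : (U⁻¹ *ᵥ p) i ≤ 0 := by
    simp only [p, mulVec_sub, mulVec_smul, mulVec_single_one, Pi.sub_apply, Pi.smul_apply,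
      col_apply, smul_eq_mul, t, div_mul_cancel₀ _ hpos.ne', sub_nonpos]
    exact le_abs_self _
  have hp := h.mulVec_nonpos (z := U⁻¹ *ᵥ p) (fun k hk => by
    have hki : k ≠ i := by
      rintro rfl
      exact hk.not_ge hzi
    have hjk : (0 : ℝ) ≤ Pi.single (M := fun _ => ℝ) j 1 k :=
      (Pi.single_nonneg.mpr zero_le_one : (0 : Fin n → ℝ) ≤ Pi.single j 1) k
    rw [hUz]
    simpa [p, hki] using mul_nonneg ht hjk) i
  rw [hUz] at hp
  simp only [p, Pi.sub_apply, Pi.smul_apply, Pi.single_eq_same, Pi.single_eq_of_ne hij,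
    smul_zero, sub_zero] at hp
  exact zero_lt_one.not_ge hp

/-- A nonnegative nonsingular matrix whose inverse has nonpositive off-diagonal entries
satisfies the Domination Principle. -/
theorem satisfiesDP_of_inv_offDiag_nonpos {n : ℕ} {U : Matrix (Fin n) (Fin n) ℝ}
    (hU : ∀ i j, 0 ≤ U i j) (hns : IsUnit U.det) (hoff : ∀ i j, i ≠ j → U⁻¹ i j ≤ 0) :
    SatisfiesDP U := by
  intro x y hx hy hxy j
  let p := U *ᵥ (x - y)
  have hp : ∀ k, p k = (U *ᵥ x) k - (U *ᵥ y) k := fun k => by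
    simp only [p, mulVec_sub, Pi.sub_apply]
  have hinv : U⁻¹ *ᵥ p = x - y := by
    rw [mulVec_mulVec, nonsing_inv_mul U hns, one_mulVec]
  have hneg : ∀ i, (U⁻¹ *ᵥ p⁺) i ≤ 0 := by
    intro i
    rcases le_or_gt (p i) 0 with hi | hi
    · exact mulVec_nonpos_of_offDiag_nonpos hoff (posPart_nonneg p) (posPart_eq_zero.mpr hi)
    · have hxi : x i = 0 := by
        refine le_antisymm (not_lt.mp fun hxi => ?_) (hx i)
        linarith [hxy i hxi, hp i]
      have hm : (U⁻¹ *ᵥ p⁻) i ≤ 0 :=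
        mulVec_nonpos_of_offDiag_nonpos hoff (negPart_nonneg p) (negPart_eq_zero.mpr hi.le)
      have hsplit : (U⁻¹ *ᵥ p⁺) i - (U⁻¹ *ᵥ p⁻) i = x i - y i := by
        rw [← Pi.sub_apply, ← mulVec_sub, posPart_sub_negPart, hinv, Pi.sub_apply]
      linarith [hy i]
  have hpos : p⁺ j ≤ 0 := by
    have hcancel : U *ᵥ (U⁻¹ *ᵥ p⁺) = p⁺ := by
      rw [mulVec_mulVec, mul_nonsing_inv U hns, one_mulVec]
    rw [← hcancel]
    simp only [mulVec, dotProduct] at hneg ⊢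
    exact Finset.sum_nonpos fun k _ => mul_nonpos_of_nonneg_of_nonpos (hU j k) (hneg k)
  linarith [le_posPart p j, hp j]

/-- For a nonnegative nonsingular matrix `U`, `U⁻¹` is an M-matrix iff
`U` satisfies the Domination Principle. -/
theorem stmt_15 {n : ℕ} (U : Matrix (Fin n) (Fin n) ℝ)
    (hU : ∀ i j, 0 ≤ U i j) (hns : IsUnit U.det) :
    IsMMatrix U⁻¹ ↔ SatisfiesDP U := by
  refine ⟨fun h => satisfiesDP_of_inv_offDiag_nonpos hU hns h.2.1, fun h =>
    ⟨isUnit_nonsing_inv_det U hns, fun _ _ => h.inv_offDiag_nonpos hns, ?_⟩⟩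
  rwa [nonsing_inv_nonsing_inv U hns]
end

section
/- Let U be a nonnegative real n×n matrix with strictly positive diagonal entries. Then U satisfies the Complete Maximum Principle if and only if U satisfies the Domination Principle and there exists a nonnegative vector μ ∈ ℝⁿ with Uμ = 𝟙. -/
open Matrix Finset

theorem SatisfiesCMP.mulVec_nonpos {n : ℕ} {U : Matrix (Fin n) (Fin n) ℝ} (h : SatisfiesCMP U)
    (x : Fin n → ℝ) (hx : ∀ i, 0 ≤ x i → U.mulVec x i ≤ 0) (j : Fin n) :
    U.mulVec x j ≤ 0 := by
  by_contra! hj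
  have hc : 0 < 2 / U.mulVec x j := by positivity
  have key := h ((2 / U.mulVec x j) • x) (fun i hi => ?_) j
  · rw [mulVec_smul, Pi.smul_apply, smul_eq_mul, div_mul_cancel₀ _ hj.ne'] at key
    norm_num at key
  · rw [Pi.smul_apply, smul_eq_mul] at hi
    rw [mulVec_smul, Pi.smul_apply, smul_eq_mul]
    have hi' := hx i (nonneg_of_mul_nonneg_right hi hc)
    nlinarith

theorem SatisfiesCMP.satisfiesDP {n : ℕ} {U : Matrix (Fin n) (Fin n) ℝ}
    (hU : ∀ i j, 0 ≤ U i j) (h : SatisfiesCMP U) : SatisfiesDP U := by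
  intro x y _ hy hxy j
  have hone : ∀ i, 0 ≤ U.mulVec 1 i := fun i => by
    simpa [mulVec, dotProduct] using Finset.sum_nonneg fun k (_ : k ∈ Finset.univ) => hU i k
  have hεj : ∀ ε : ℝ, 0 < ε → U.mulVec x j - U.mulVec y j ≤ ε * U.mulVec 1 j := by
    intro ε hε
    have expand : ∀ i, U.mulVec (x - y - ε • 1) i
        = U.mulVec x i - U.mulVec y i - ε * U.mulVec 1 i := fun i => by
      simp [mulVec_sub, mulVec_smul]
    have key := h.mulVec_nonpos (x - y - ε • 1) (fun i hi => ?_) j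
    · rw [expand] at key
      linarith
    · simp only [Pi.sub_apply, Pi.smul_apply, Pi.one_apply, smul_eq_mul, mul_one] at hi
      have := hxy i (by linarith [hy i])
      have := mul_nonneg hε.le (hone i)
      rw [expand]
      linarith
  by_contra! hlt
  have hpos : 0 < U.mulVec 1 j + 1 := by linarith [hone j]
  have hd : 0 < U.mulVec x j - U.mulVec y j := by linarith
  have key := hεj ((U.mulVec x j - U.mulVec y j) / (U.mulVec 1 j + 1)) (by positivity)
  rw [div_mul_eq_mul_div, le_div_iff₀ hpos] at key
  linarith

/-- The regularized equilibrium equation `(U + ε) μ = 𝟙` has a nonnegative solution. -/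
theorem SatisfiesCMP.exists_regularized {n : ℕ} {U : Matrix (Fin n) (Fin n) ℝ}
    (h : SatisfiesCMP U) {ε : ℝ} (hε : 0 < ε) :
    ∃ μ : Fin n → ℝ, (∀ i, 0 ≤ μ i) ∧ ∀ i, U.mulVec μ i + ε * μ i = 1 := by
  have happ : ∀ x i, (U + ε • (1 : Matrix (Fin n) (Fin n) ℝ)).mulVec x i
      = U.mulVec x i + ε * x i := fun x i => by
    simp [add_mulVec, smul_mulVec]
  have hnonneg : ∀ x : Fin n → ℝ, (∀ i, U.mulVec x i + ε * x i = 0) → ∀ i, 0 ≤ x i := by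
    intro x hx i
    have := h.mulVec_nonpos x (fun k hk => by
      have := mul_nonneg hε.le hk
      linarith [hx k]) i
    exact nonneg_of_mul_nonneg_right (by linarith [hx i] : 0 ≤ ε * x i) hε
  have hinj : Function.Injective
      (U + ε • (1 : Matrix (Fin n) (Fin n) ℝ)).mulVecLin := by
    rw [injective_iff_map_eq_zero]
    intro x hx
    have hx' : ∀ i, U.mulVec x i + ε * x i = 0 := fun i => by
      rw [← happ, ← mulVecLin_apply, hx, Pi.zero_apply]
    funext i
    have h1 := hnonneg x hx' i
    have h2 := hnonneg (-x) (fun k => by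
      rw [mulVec_neg, Pi.neg_apply, Pi.neg_apply]
      linarith [hx' k]) i
    rw [Pi.neg_apply] at h2
    exact le_antisymm (neg_nonneg.mp h2) h1
  obtain ⟨μ, hμ⟩ := LinearMap.injective_iff_surjective.mp hinj 1
  have hμ' : ∀ i, U.mulVec μ i + ε * μ i = 1 := fun i => by
    rw [← happ, ← mulVecLin_apply, hμ, Pi.one_apply]
  refine ⟨μ, fun i => ?_, hμ'⟩
  have := h μ (fun k hk => by
    have := mul_nonneg hε.le hk
    linarith [hμ' k]) i
  exact nonneg_of_mul_nonneg_right (by linarith [hμ' i] : 0 ≤ ε * μ i) hε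

theorem SatisfiesCMP.exists_equilibrium {n : ℕ} {U : Matrix (Fin n) (Fin n) ℝ}
    (hU : ∀ i j, 0 ≤ U i j) (hdiag : ∀ i, 0 < U i i) (h : SatisfiesCMP U) :
    ∃ μ : Fin n → ℝ, (∀ i, 0 ≤ μ i) ∧ U.mulVec μ = fun _ => 1 := by
  set K : Set (Fin n → ℝ) := Set.Icc 0 fun i => 1 / U i i
  have hclosed : IsClosed (U.mulVec '' K) :=
    (isCompact_Icc.image (Continuous.matrix_mulVec continuous_const continuous_id)).isClosed
  choose μ hμ0 hμ using fun k : ℕ =>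
    h.exists_regularized (Nat.one_div_pos_of_nat (α := ℝ) (n := k))
  have hle : ∀ k i, μ k i ≤ 1 / U i i := fun k i => by
    rw [le_div_iff₀ (hdiag i), mul_comm]
    have h1 : U i i * μ k i ≤ U.mulVec (μ k) i :=
      Finset.single_le_sum (f := fun j => U i j * μ k j)
        (fun j _ => mul_nonneg (hU i j) (hμ0 k j)) (Finset.mem_univ i)
    have h2 := mul_nonneg (Nat.one_div_pos_of_nat (α := ℝ) (n := k)).le (hμ0 k i)
    linarith [hμ k i]
  have hlim : Filter.Tendsto (fun k => U.mulVec (μ k)) Filter.atTop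
      (nhds fun _ => (1 : ℝ)) := by
    rw [tendsto_pi_nhds]
    intro i
    have hlow : Filter.Tendsto (fun k : ℕ => 1 - 1 / ((k : ℝ) + 1) * (1 / U i i))
        Filter.atTop (nhds 1) := by
      simpa using ((tendsto_one_div_add_atTop_nhds_zero_nat (𝕜 := ℝ)).mul_const
        (1 / U i i)).const_sub 1
    refine tendsto_of_tendsto_of_tendsto_of_le_of_le hlow tendsto_const_nhds
      (fun k => ?_) (fun k => ?_)
    · have := mul_le_mul_of_nonneg_left (hle k i)
        (Nat.one_div_pos_of_nat (α := ℝ) (n := k)).le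
      change 1 - 1 / ((k : ℝ) + 1) * (1 / U i i) ≤ U.mulVec (μ k) i
      linarith [hμ k i]
    · have := mul_nonneg (Nat.one_div_pos_of_nat (α := ℝ) (n := k)).le (hμ0 k i)
      change U.mulVec (μ k) i ≤ 1
      linarith [hμ k i]
  obtain ⟨ν, hν, hν1⟩ := hclosed.mem_of_tendsto hlim
    (Filter.Eventually.of_forall fun k => ⟨μ k, ⟨hμ0 k, hle k⟩, rfl⟩)
  exact ⟨ν, hν.1, hν1⟩

theorem SatisfiesDP.satisfiesCMP {n : ℕ} {U : Matrix (Fin n) (Fin n) ℝ} (h : SatisfiesDP U)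
    {μ : Fin n → ℝ} (hμ : ∀ i, 0 ≤ μ i) (hUμ : U.mulVec μ = fun _ => 1) :
    SatisfiesCMP U := by
  intro x hx j
  have hsplit : ∀ i, U.mulVec x i = U.mulVec x⁺ i - U.mulVec x⁻ i := fun i => by
    rw [← Pi.sub_apply, ← mulVec_sub, posPart_sub_negPart]
  have hadd : ∀ i, U.mulVec (μ + x⁻) i = 1 + U.mulVec x⁻ i := fun i => by
    rw [mulVec_add, hUμ, Pi.add_apply]
  have key := h x⁺ (μ + x⁻) (posPart_nonneg x)
    (fun i => add_nonneg (hμ i) (negPart_nonneg x i)) (fun i hi => ?_) j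
  · rw [hadd] at key
    linarith [hsplit j]
  · rw [Pi.posPart_apply, posPart_pos_iff] at hi
    rw [hadd]
    linarith [hsplit i, hx i hi.le]

/-- A nonnegative matrix `U` with strictly positive diagonal satisfies
the CMP iff it satisfies the DP and there is a nonnegative `μ` with `Uμ = 𝟙`. -/
theorem stmt_16 {n : ℕ} (U : Matrix (Fin n) (Fin n) ℝ)
    (hU : ∀ i j, 0 ≤ U i j) (hdiag : ∀ i, 0 < U i i) :
    SatisfiesCMP U ↔
      SatisfiesDP U ∧ ∃ μ : Fin n → ℝ, (∀ i, 0 ≤ μ i) ∧ U.mulVec μ = fun _ => 1 := by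
  exact ⟨fun h => ⟨h.satisfiesDP hU, h.exists_equilibrium hU hdiag⟩,
    fun ⟨h, _, hμ, hUμ⟩ => h.satisfiesCMP hμ hUμ⟩
end
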